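/- For all positive integers m, n and all u ∈ ℂ, the Mordell integral at the rational parameter τ = m/n satisfies (e^{πin(m + 2u)} − 1)·Υ(u; m/n) = e^{3πi/4}·(√n/√m)·Σ_{j=0}^{m−1} e^{πi(j+u)²·n/m} + e^{πi(m+u)²·n/m}·Σ_{j=0}^{n−1} e^{−πi(j + nu/m)²·m/n}. -/

import Mathlib

open Complex Real MeasureTheory

noncomputable section

def chi (s : ℂ) : ℂ := (π : ℂ) ^ (s - 1/2) * Complex.Gamma ((1 - s)/2) / Complex.Gamma (s/2)

def RSOmega : Set ℂ := {s : ℂ | s.im ≠ 0 ∨ (0 < s.re ∧ s.re < 1)}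

def IsRSTheta (ϑ : ℂ → ℂ) : Prop :=
  DifferentiableOn ℂ ϑ RSOmega ∧ (∀ s ∈ RSOmega, Complex.exp (-2 * I * ϑ s) = chi s) ∧
    ϑ (1/2) = 0

def zetaSum (x : ℝ) (s : ℂ) : ℂ := ∑ n ∈ Finset.Icc 1 ⌊x⌋₊, (n : ℂ) ^ (-s)

def Upsilon (u τ : ℂ) : ℂ :=
  ∫ v : ℝ, Complex.exp (3 * (π:ℂ) * I / 4) *
    (Complex.exp (-(π:ℂ) * I * τ * (1/2 + Complex.exp (3 * (π:ℂ) * I / 4) * v) ^ 2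
        + 2 * (π:ℂ) * I * u * (1/2 + Complex.exp (3 * (π:ℂ) * I / 4) * v)) /
      (Complex.exp (2 * (π:ℂ) * I * (1/2 + Complex.exp (3 * (π:ℂ) * I / 4) * v)) - 1))

def G (u τ : ℂ) : ℂ :=
  τ ^ ((1:ℂ)/4) * Complex.exp (-(π:ℂ) * I * u ^ 2 / 2 + (π:ℂ) * I / 8) *
    Upsilon (τ ^ ((1:ℂ)/2) * u) τ

def Gderiv (k : ℕ) (u τ : ℂ) : ℂ := iteratedDeriv k (fun w => G w τ) u

def hermiteH (n : ℕ) (x : ℂ) : ℂ :=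
  (Nat.factorial n : ℂ) * ∑ j ∈ Finset.range (n / 2 + 1),
    (-1:ℂ) ^ j / ((Nat.factorial j : ℂ) * (Nat.factorial (n - 2*j) : ℂ)) * (2 * x) ^ (n - 2*j)

def obell (p : ℕ → ℂ) (i j : ℕ) : ℂ :=
  ∑ f ∈ (Finset.Nat.antidiagonalTuple j i).filter (fun f => ∀ l, 1 ≤ f l), ∏ l, p (f l)

def bernoulliPoly (n : ℕ) (x : ℂ) : ℂ := Polynomial.aeval x (Polynomial.bernoulli n)

def fseq (σ : ℝ) (n : ℕ) : ℂ :=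
  (bernoulliPoly (n+1) ((σ:ℂ)/2) + (-1:ℂ)^(n+1) * bernoulliPoly (n+1) ((1-(σ:ℂ))/2)) /
    (2*(n:ℂ)*((n:ℂ)+1))

def um (m : ℕ) (σ : ℝ) : ℂ :=
  (-2:ℂ)^m * ∑ k ∈ Finset.range (m+1), obell (fseq σ) m k / (Nat.factorial k : ℂ)

def seqA (j : ℕ) : ℂ := (-1:ℂ)^(j+1) / ((j:ℂ) + 2)

def seqB (j : ℕ) : ℂ := (-1:ℂ)^(j+1) / (j:ℂ)

def dd (m r : ℕ) (σ : ℝ) : ℂ :=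
  ∑ n ∈ Finset.Icc r m, (obell seqA n r / (Nat.factorial r : ℂ)) *
    ∑ k ∈ Finset.range (m - n + 1),
      (obell seqB (m - n) k / (Nat.factorial k : ℂ)) * ((σ:ℂ) - 1)^k

def qq (n ℓ : ℕ) (σ : ℝ) : ℂ :=
  ∑ m ∈ Finset.Icc (ℓ - n) (ℓ / 3), um m σ * dd (n - 2*m) (n + m - ℓ) σ

def PP (n k : ℕ) (x : ℂ) (σ : ℝ) : ℂ :=
  Complex.exp (3 * (π:ℂ) * I * (k:ℂ) / 4) * ∑ ℓ ∈ Finset.range (k/2 + 1),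
    (Nat.choose (3*n - 2*ℓ) (3*n - k) : ℂ) * (-1:ℂ)^(n + ℓ) * 2^(2*ℓ) / 2^k *
      qq n ℓ σ * hermiteH (k - 2*ℓ) (Complex.exp (-(π:ℂ) * I / 4) * x)

def IsAk (s : ℂ) (a : ℕ → ℂ) : Prop :=
  a 0 = 1 ∧ ∀ k : ℕ, ((k:ℂ) + 1) * (Real.sqrt s.im : ℂ) * a (k+1) =
    -((k:ℂ) + 1 - (s.re:ℂ)) * a k + I * (if 2 ≤ k then a (k-2) else 0)

def IsPsi (Ψ : ℂ → ℂ) : Prop :=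
  Differentiable ℂ Ψ ∧ ∀ u : ℂ, Complex.cos ((π:ℂ)*u) ≠ 0 →
    Ψ u = Complex.cos ((π:ℂ)*(u^2/2 - u - 1/8)) / Complex.cos ((π:ℂ)*u)

def wfun (s z : ℂ) : ℂ :=
  Complex.exp ((s - 1) * Complex.log (1 + z / (Real.sqrt s.im : ℂ))
    - I * (Real.sqrt s.im : ℂ) * z + I * z^2 / 2)

def rn (n : ℕ) (s z : ℂ) : ℂ :=
  wfun s z - ∑ k ∈ Finset.range n, (iteratedDeriv k (wfun s) 0 / (Nat.factorial k : ℂ)) * z^k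

def GammaOmega : Set ℂ := {s : ℂ | s.im ≠ 0 ∨ 0 < s.re}

def IsLogGamma (L : ℂ → ℂ) : Prop :=
  DifferentiableOn ℂ L GammaOmega ∧ (∀ s ∈ GammaOmega, Complex.exp (L s) = Complex.Gamma s) ∧
    L 1 = 0

def gseq (σ : ℝ) (n : ℕ) : ℂ := -(bernoulliPoly (n+1) (σ:ℂ)) / ((n:ℂ)*((n:ℂ)+1))

def gammam (m : ℕ) (σ : ℝ) : ℂ :=
  I^m * ∑ k ∈ Finset.range (m+1), obell (gseq σ) m k / (Nat.factorial k : ℂ)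

open Filter Topology

namespace MI


def ee : ℂ := Complex.exp (3 * (π:ℂ) * I / 4)

def ss : ℝ := Real.sqrt 2 / 2

lemma ss_sq : ss ^ 2 = 1 / 2 := by
  unfold ss; rw [div_pow, Real.sq_sqrt (by norm_num)]; norm_num

lemma ss_pos : 0 < ss := by unfold ss; positivity

lemma ss_lt : ss < 1 := by nlinarith [ss_sq, ss_pos]

lemma ss_gt : 1 / 2 < ss := by nlinarith [ss_sq, ss_pos]

lemma ee_eq : ee = (ss : ℂ) * (-1 + I) := by
  have h : (3 * (π:ℂ) * I / 4) = ((π - π / 4 : ℝ) : ℂ) * I := by push_cast; ring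
  unfold ee
  rw [h, Complex.exp_mul_I, ← Complex.ofReal_cos, ← Complex.ofReal_sin, Real.cos_pi_sub,
    Real.sin_pi_sub, Real.cos_pi_div_four, Real.sin_pi_div_four, ss]
  push_cast; ring

lemma ss_sqC : (ss : ℂ) ^ 2 = 1 / 2 := by
  rw [← Complex.ofReal_pow, ss_sq]; push_cast; rfl

lemma ee_sq : ee ^ 2 = -I := by
  rw [ee_eq, mul_pow, ss_sqC]
  linear_combination (1 / 2) * Complex.I_sq

lemma ee_ne : ee ≠ 0 := Complex.exp_ne_zero _

def zz (w : ℂ) : ℂ := 1 / 2 + ee * w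

def F (τ : ℝ) (u z : ℂ) : ℂ := Complex.exp (-(π:ℂ) * I * τ * z ^ 2 + 2 * (π:ℂ) * I * u * z)

def L (z : ℂ) : ℂ := Complex.exp (2 * (π:ℂ) * I * z) - 1

lemma Ups_eq (u : ℂ) (τ : ℝ) : Upsilon u τ = ∫ v : ℝ, ee * (F τ u (zz v) / L (zz v)) := rfl

lemma F_zz (τ : ℝ) (u w : ℂ) : F τ u (zz w) =
    Complex.exp (-((π * τ : ℝ) : ℂ) * w ^ 2 + (ee * (-(π:ℂ) * I * τ + 2 * π * I * u)) * w +
      (-(π:ℂ) * I * τ / 4 + π * I * u)) := by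
  unfold F zz
  congr 1
  push_cast
  linear_combination (-(π:ℂ) * I * τ * w ^ 2) * ee_sq + (π * τ * w ^ 2) * Complex.I_sq

lemma zz_im (a b : ℝ) : (zz (a + b * I)).im = ss * (a - b) := by
  simp [zz, ee_eq]; ring

lemma zz_re (a b : ℝ) : (zz (a + b * I)).re = 1 / 2 - ss * (a + b) := by
  simp [zz, ee_eq]; ring

lemma L_zero {z : ℂ} (h : L z = 0) : z.im = 0 ∧ ∃ n : ℤ, z.re = n := by
  unfold L at h
  obtain ⟨n, hn⟩ := Complex.exp_eq_one_iff.1 (sub_eq_zero.1 h)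
  have : z = n := by
    have hp : (2 * (π:ℂ) * I) ≠ 0 := Complex.two_pi_I_ne_zero
    apply mul_left_cancel₀ hp
    rw [hn]; ring
  rw [this]
  simp

lemma L_ne {a b : ℝ} (hb : -ss ≤ b) (hb' : b ≤ 0) (h : zz (a + b * I) ≠ 1) :
    L (zz (a + b * I)) ≠ 0 := by
  intro h0
  obtain ⟨h1, n, hn⟩ := L_zero h0
  have h1' := h1
  rw [zz_im] at h1
  have hab : a = b := by
    have := (mul_eq_zero.1 h1).resolve_left ss_pos.ne'
    linarith
  have hn' := hn
  rw [zz_re, hab] at hn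
  have h2 : (n : ℝ) ≤ 3 / 2 := by nlinarith [ss_sq, ss_pos]
  have h3 : (1 / 2 : ℝ) ≤ n := by nlinarith [ss_sq, ss_pos]
  have h4 : n < 2 := by exact_mod_cast (lt_of_le_of_lt h2 (by norm_num) : (n : ℝ) < 2)
  have h5 : 0 < n := by exact_mod_cast (lt_of_lt_of_le (by norm_num) h3 : (0 : ℝ) < n)
  have h6 : n = 1 := by omega
  apply h
  apply Complex.ext
  · rw [hn', h6]; simp
  · rw [h1']; simp

lemma L_ne_line (v : ℝ) : L (zz v) ≠ 0 := by
  have := @L_ne v 0 (by linarith [ss_pos]) le_rfl ?_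
  · simpa using this
  · intro h
    have h1 := congrArg Complex.im h
    have h2 := congrArg Complex.re h
    rw [zz_im] at h1
    rw [zz_re] at h2
    simp at h1 h2
    rcases h1 with h1 | h1
    · exact ss_pos.ne' h1
    · rw [h1] at h2; norm_num at h2

lemma exp_big : 2 ≤ Real.exp (2 * π) := by
  have := Real.add_one_le_exp (2 * π)
  linarith [Real.pi_gt_three]

lemma L_big {z : ℂ} (h : 1 ≤ |z.im|) : 1 / 2 ≤ ‖L z‖ := by
  have hn : ‖Complex.exp (2 * (π:ℂ) * I * z)‖ = Real.exp (-2 * π * z.im) := by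
    rw [Complex.norm_exp]; simp
  rcases le_abs.1 h with h | h
  · have h1 : Real.exp (-2 * π * z.im) ≤ 1 / 2 := by
      have : Real.exp (-2 * π * z.im) ≤ Real.exp (-(2 * π)) := by
        apply Real.exp_le_exp.2; nlinarith [Real.pi_pos]
      rw [Real.exp_neg] at this
      refine this.trans ?_
      rw [inv_eq_one_div]
      exact one_div_le_one_div_of_le (by norm_num) exp_big
    have := norm_sub_norm_le (1 : ℂ) (Complex.exp (2 * (π:ℂ) * I * z))
    rw [norm_sub_rev, hn, norm_one] at this
    unfold L; linarith
  · have h1 : 2 ≤ Real.exp (-2 * π * z.im) := by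
      refine exp_big.trans ?_
      apply Real.exp_le_exp.2; nlinarith [Real.pi_pos]
    have := norm_sub_norm_le (Complex.exp (2 * (π:ℂ) * I * z)) (1 : ℂ)
    rw [hn, norm_one] at this
    unfold L; linarith

lemma zz_big {T y : ℝ} (hT : 3 ≤ |T|) (hy : -ss ≤ y) (hy' : y ≤ 0) :
    1 ≤ |(zz (T + y * I)).im| := by
  rw [zz_im, abs_mul, abs_of_pos ss_pos]
  have : 2 ≤ |T - y| := by
    have := abs_sub_abs_le_abs_sub T y
    have h2 : |y| ≤ 1 := abs_le.2 ⟨by linarith [ss_lt], by linarith⟩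
    linarith
  nlinarith [ss_gt]

lemma L_cont : Continuous L := by unfold L; fun_prop
lemma L_diff : Differentiable ℂ L := by unfold L; fun_prop
lemma F_diff (τ : ℝ) (u : ℂ) : Differentiable ℂ (F τ u) := by unfold F; fun_prop
lemma zz_cont : Continuous zz := by unfold zz; fun_prop
lemma zz_diff : Differentiable ℂ zz := by unfold zz; fun_prop

lemma invL_cont : Continuous (fun v : ℝ => (L (zz v))⁻¹) := by
  refine Continuous.inv₀ ?_ L_ne_line
  exact L_cont.comp (zz_cont.comp Complex.continuous_ofReal)

lemma invL_bdd : ∃ C, ∀ v : ℝ, ‖(L (zz v))⁻¹‖ ≤ C := by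
  obtain ⟨C, hC⟩ := (isCompact_Icc (a := (-3:ℝ)) (b := 3)).exists_bound_of_continuousOn
    invL_cont.continuousOn
  refine ⟨max C 2, fun v => ?_⟩
  by_cases hv : |v| ≤ 3
  · exact (hC v (abs_le.1 hv)).trans (le_max_left _ _)
  · refine le_trans ?_ (le_max_right _ _)
    have := L_big (zz_big (y := 0) (le_of_lt (not_le.1 hv)) (by linarith [ss_pos]) le_rfl)
    simp only [Complex.ofReal_zero, zero_mul, add_zero] at this
    rw [norm_inv, inv_eq_one_div, div_le_iff₀ (by linarith)]
    linarith

lemma F_int {τ : ℝ} (hτ : 0 < τ) (u : ℂ) : Integrable (fun v : ℝ => F τ u (zz v)) := by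
  simp_rw [F_zz]
  apply integrable_cexp_quadratic
  rw [Complex.ofReal_re]; positivity

lemma FL_int {τ : ℝ} (hτ : 0 < τ) (u : ℂ) :
    Integrable (fun v : ℝ => F τ u (zz v) / L (zz v)) := by
  obtain ⟨C, hC⟩ := invL_bdd
  exact (F_int hτ u).mul_bdd invL_cont.aestronglyMeasurable (Eventually.of_forall hC)

/-- Gaussian integral along the line. -/
lemma F_gauss {τ : ℝ} (hτ : 0 < τ) (u : ℂ) :
    ∫ v : ℝ, F τ u (zz v) = ((1 / Real.sqrt τ : ℝ) : ℂ) * Complex.exp (π * I * u ^ 2 / τ) := by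
  simp_rw [F_zz]
  rw [integral_cexp_quadratic (by rw [Complex.neg_re, Complex.ofReal_re]; simp; positivity)]
  have hτ' : (τ : ℂ) ≠ 0 := by exact_mod_cast hτ.ne'
  have hπ : (π : ℂ) ≠ 0 := by exact_mod_cast Real.pi_pos.ne'
  congr 1
  · rw [neg_neg]
    have : (π : ℂ) / ((π * τ : ℝ) : ℂ) = ((1 / τ : ℝ) : ℂ) := by
      push_cast; field_simp
    rw [this, show (1 / 2 : ℂ) = ((1 / 2 : ℝ) : ℂ) by push_cast; rfl,
      ← Complex.ofReal_cpow (by positivity), ← Real.sqrt_eq_rpow, Real.sqrt_div (by norm_num),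
      Real.sqrt_one]
  · congr 1
    rw [mul_pow, ee_sq]
    push_cast
    field_simp
    ring_nf
    linear_combination (4 * τ * u - τ ^ 2 - 4 * u ^ 2) * Complex.I_sq

lemma Ups_succ {τ : ℝ} (hτ : 0 < τ) (u : ℂ) :
    Upsilon (u + 1) τ = Upsilon u τ +
      ee * (((1 / Real.sqrt τ : ℝ) : ℂ) * Complex.exp (π * I * u ^ 2 / τ)) := by
  rw [Ups_eq, Ups_eq, ← F_gauss hτ, integral_const_mul, integral_const_mul, ← mul_add,
    ← integral_add (FL_int hτ u) (F_int hτ u)]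
  congr 2
  ext v
  have := L_ne_line v
  field_simp
  unfold F L
  rw [add_sub_cancel, ← Complex.exp_add]
  ring_nf

def Dec (g : ℂ → ℂ) : Prop := ∃ b : ℝ → ℝ, Tendsto b atTop (𝓝 0) ∧
  ∀ᶠ T : ℝ in atTop, ∀ y : ℝ, -ss ≤ y → y ≤ 0 →
    ‖g (((T : ℝ) : ℂ) + y * I)‖ ≤ b T ∧ ‖g (((-T : ℝ) : ℂ) + y * I)‖ ≤ b T

lemma shift (g : ℂ → ℂ) (hd : ∀ w : ℂ, -ss ≤ w.im → w.im ≤ 0 → DifferentiableAt ℂ g w)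
    (h0 : Integrable (fun v : ℝ => g v)) (h1 : Integrable (fun v : ℝ => g (v + (-ss : ℝ) * I)))
    (hdec : Dec g) : ∫ v : ℝ, g v = ∫ v : ℝ, g (v + (-ss : ℝ) * I) := by
  obtain ⟨b, hb, hT⟩ := hdec
  have e0 := intervalIntegral_tendsto_integral h0 tendsto_neg_atTop_atBot tendsto_id
  have e1 := intervalIntegral_tendsto_integral h1 tendsto_neg_atTop_atBot tendsto_id
  have key : ∀ T : ℝ, (∫ x : ℝ in -T..T, g (x + (-ss : ℝ) * I)) - (∫ x : ℝ in -T..T, g x) =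
      I * (∫ y : ℝ in -ss..0, g (((-T : ℝ) : ℂ) + y * I)) -
      I * (∫ y : ℝ in -ss..0, g (((T : ℝ) : ℂ) + y * I)) := by
    intro T
    have := Complex.integral_boundary_rect_eq_zero_of_differentiableOn g
      (((-T : ℝ) : ℂ) + (-ss : ℝ) * I) (((T : ℝ) : ℂ) + (0 : ℝ) * I) ?_
    · simp only [Complex.add_re, Complex.ofReal_re, Complex.mul_re, Complex.I_re, mul_zero,
        Complex.ofReal_im, Complex.I_im, mul_one, sub_self, add_zero, Complex.add_im,
        Complex.mul_im, zero_add, Complex.ofReal_zero, zero_mul, smul_eq_mul] at this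
      linear_combination this
    · intro w hw
      rw [Complex.mem_reProdIm] at hw
      have h2 := hw.2
      simp only [Complex.add_im, Complex.ofReal_im, Complex.mul_im, Complex.ofReal_re,
        Complex.I_im, mul_one, Complex.I_re, mul_zero, add_zero, zero_add] at h2
      rw [Set.uIcc_of_le (by linarith [ss_pos])] at h2
      exact (hd w h2.1 h2.2).differentiableWithinAt
  have hz : Tendsto (fun T : ℝ => (∫ x : ℝ in -T..T, g (x + (-ss : ℝ) * I)) -
      (∫ x : ℝ in -T..T, g x)) atTop (𝓝 0) := by
    have hb2 : Tendsto (fun T => 2 * (b T * |0 - -ss|)) atTop (𝓝 0) := by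
      simpa using (hb.mul_const (|0 - -ss|)).const_mul 2
    refine squeeze_zero_norm' ?_ hb2
    filter_upwards [hT] with T hT
    rw [key]
    have n1 : ‖∫ y : ℝ in -ss..0, g (((-T : ℝ) : ℂ) + y * I)‖ ≤ b T * |0 - -ss| := by
      apply intervalIntegral.norm_integral_le_of_norm_le_const
      intro y hy
      rw [Set.uIoc_of_le (by linarith [ss_pos])] at hy
      exact (hT y hy.1.le hy.2).2
    have n2 : ‖∫ y : ℝ in -ss..0, g (((T : ℝ) : ℂ) + y * I)‖ ≤ b T * |0 - -ss| := by
      apply intervalIntegral.norm_integral_le_of_norm_le_const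
      intro y hy
      rw [Set.uIoc_of_le (by linarith [ss_pos])] at hy
      exact (hT y hy.1.le hy.2).1
    refine (norm_sub_le _ _).trans ?_
    rw [norm_mul, norm_mul, Complex.norm_I]
    linarith
  have := tendsto_nhds_unique hz (e1.sub e0)
  exact (sub_eq_zero.1 this.symm).symm

lemma F_dec {τ : ℝ} (hτ : 0 < τ) (u : ℂ) : Dec (fun w => F τ u (zz w)) := by
  set β := (ee * (-(π:ℂ) * I * τ + 2 * π * I * u)) with hβ
  set γ := (-(π:ℂ) * I * τ / 4 + π * I * u) with hγ
  have ha : 0 < π * τ := by positivity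
  set a := π * τ with hadef
  have main : ∀ T' T y : ℝ, |T'| = T → -ss ≤ y → y ≤ 0 → ‖F τ u (zz ((T' : ℂ) + y * I))‖ ≤
      Real.exp (-a * T ^ 2 + ‖β‖ * T + (a + ‖β‖ + ‖γ‖)) := by
    intro T' T y hTT hy hy'
    rw [F_zz, ← hβ, ← hγ, ← hadef, Complex.norm_exp]
    apply Real.exp_le_exp.2
    have hs : T' ^ 2 = T ^ 2 := by rw [← hTT, sq_abs]
    have hre : (-((a : ℝ) : ℂ) * ((T' : ℂ) + y * I) ^ 2 + β * ((T' : ℂ) + y * I) + γ).re =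
        -a * (T' ^ 2 - y ^ 2) + (β.re * T' - β.im * y) + γ.re := by
      simp [pow_two]
    rw [hre, hs]
    have h1 : β.re * T' ≤ ‖β‖ * T := by
      refine (le_abs_self _).trans ?_
      rw [abs_mul, hTT]
      exact mul_le_mul_of_nonneg_right (Complex.abs_re_le_norm β) (by rw [← hTT]; positivity)
    have hy1 : |y| ≤ 1 := abs_le.2 ⟨by linarith [ss_lt], by linarith⟩
    have h2 : -(β.im * y) ≤ ‖β‖ := by
      refine (neg_le_abs _).trans ?_
      rw [abs_mul]
      calc |β.im| * |y| ≤ ‖β‖ * 1 :=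
            mul_le_mul (Complex.abs_im_le_norm β) hy1 (abs_nonneg _) (norm_nonneg _)
        _ = _ := mul_one _
    have h3 : γ.re ≤ ‖γ‖ := Complex.re_le_norm γ
    have h4 : y ^ 2 ≤ 1 := by nlinarith [ss_lt]
    nlinarith
  refine ⟨fun T => Real.exp (-a * T ^ 2 + ‖β‖ * T + (a + ‖β‖ + ‖γ‖)), ?_, ?_⟩
  · apply Real.tendsto_exp_atBot.comp
    apply tendsto_atBot_add_const_right
    have : (fun T : ℝ => -a * T ^ 2 + ‖β‖ * T) = fun T => T * (-a * T + ‖β‖) := by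
      ext T; ring
    rw [this]
    apply tendsto_id.atTop_mul_atBot₀
    apply tendsto_atBot_add_const_right
    exact tendsto_id.const_mul_atTop_of_neg (by linarith)
  · filter_upwards [eventually_ge_atTop 0] with T hT y hy hy'
    exact ⟨main T T y (abs_of_nonneg hT) hy hy', main (-T) T y (by rw [abs_neg, abs_of_nonneg hT]) hy hy'⟩

lemma zz_shift (v : ℝ) : zz (v + (-ss : ℝ) * I) = zz ((v + ss : ℝ) : ℂ) + 1 := by
  unfold zz
  rw [ee_eq]
  push_cast
  linear_combination (-(ss:ℂ)^2) * Complex.I_sq + 2 * ss_sqC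

lemma L_add_one (z : ℂ) : L (z + 1) = L z := by
  unfold L
  rw [mul_add, Complex.exp_add, mul_one, Complex.exp_two_pi_mul_I, mul_one]

lemma F_add_one (τ : ℝ) (u z : ℂ) : F τ u (z + 1) =
    Complex.exp (-(π:ℂ) * I * τ + 2 * π * I * u) * F τ (u - τ) z := by
  unfold F; rw [← Complex.exp_add]; ring_nf

def K (τ : ℝ) (u z : ℂ) : ℂ := F τ u z - F τ u 1 * F 1 (1 / 2) z

lemma F1 : F 1 (1 / 2) 1 = 1 := by
  unfold F
  rw [Complex.exp_eq_one_iff]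
  exact ⟨0, by push_cast; ring⟩

lemma K_one (τ : ℝ) (u : ℂ) : K τ u 1 = 0 := by unfold K; rw [F1]; ring

lemma K_diff (τ : ℝ) (u : ℂ) : Differentiable ℂ (K τ u) :=
  (F_diff τ u).sub ((F_diff _ _).const_mul _)

lemma L_one : L 1 = 0 := by unfold L; simp [Complex.exp_two_pi_mul_I]

lemma dsl_diff {f : ℂ → ℂ} (hf : Differentiable ℂ f) : Differentiable ℂ (dslope f 1) := by
  have := (Complex.differentiableOn_dslope (f := f) (c := 1) (s := Set.univ) univ_mem).2
    hf.differentiableOn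
  exact differentiableOn_univ.1 this

lemma dsl_div (τ : ℝ) (u : ℂ) {z : ℂ} (hz : z ≠ 1) :
    dslope (K τ u) 1 z / dslope L 1 z = K τ u z / L z := by
  rw [dslope_of_ne _ hz, dslope_of_ne _ hz, slope_def_field, slope_def_field, K_one, L_one,
    sub_zero, sub_zero, div_div_div_cancel_right₀ (sub_ne_zero.2 hz)]

lemma dslL_ne {a b : ℝ} (hb : -ss ≤ b) (hb' : b ≤ 0) : dslope L 1 (zz (a + b * I)) ≠ 0 := by
  by_cases h : zz (a + b * I) = 1
  · rw [h, dslope_same]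
    have : HasDerivAt L (Complex.exp (2 * (π:ℂ) * I * 1) * (2 * π * I * 1)) 1 :=
      (((hasDerivAt_id (1:ℂ)).const_mul (2 * (π:ℂ) * I)).cexp).sub_const 1
    rw [this.deriv]
    simp [Real.pi_pos.ne']
  · rw [dslope_of_ne _ h, slope_def_field, L_one, sub_zero]
    exact div_ne_zero (L_ne hb hb' h) (sub_ne_zero.2 h)

lemma zz_line_ne (v : ℝ) : zz v ≠ 1 := fun h => L_ne_line v (by rw [h, L_one])

lemma zz_line_ne' (v : ℝ) : zz v + 1 ≠ 1 := fun h => L_ne_line v (by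
  rw [← L_add_one, h, L_one])

lemma K_int0 {τ : ℝ} (hτ : 0 < τ) (u : ℂ) : Integrable (fun v : ℝ => K τ u (zz v) / L (zz v)) := by
  have := (FL_int hτ u).sub ((FL_int one_pos (1/2)).const_mul (F τ u 1))
  refine this.congr (Eventually.of_forall fun v => ?_)
  simp only [Pi.sub_apply, K]; ring

lemma FL_int1 {τ : ℝ} (hτ : 0 < τ) (u : ℂ) :
    Integrable (fun v : ℝ => F τ u (zz v + 1) / L (zz v + 1)) := by
  simp_rw [F_add_one, L_add_one, mul_div_assoc]
  exact (FL_int hτ _).const_mul _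

lemma K_int1 {τ : ℝ} (hτ : 0 < τ) (u : ℂ) :
    Integrable (fun v : ℝ => K τ u (zz v + 1) / L (zz v + 1)) := by
  have := (FL_int1 hτ u).sub ((FL_int1 one_pos (1/2)).const_mul (F τ u 1))
  refine this.congr (Eventually.of_forall fun v => ?_)
  simp only [Pi.sub_apply, K]; ring

lemma K_shift {τ : ℝ} (hτ : 0 < τ) (u : ℂ) :
    ∫ v : ℝ, K τ u (zz v) / L (zz v) = ∫ v : ℝ, K τ u (zz v + 1) / L (zz v + 1) := by
  set g : ℂ → ℂ := fun w => dslope (K τ u) 1 (zz w) / dslope L 1 (zz w) with hg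
  have g0 : ∀ v : ℝ, g v = K τ u (zz v) / L (zz v) := fun v => dsl_div τ u (zz_line_ne v)
  have g1 : ∀ v : ℝ, g (v + (-ss : ℝ) * I) =
      (fun v : ℝ => K τ u (zz v + 1) / L (zz v + 1)) (v + ss) := by
    intro v
    simp only [hg]
    rw [zz_shift]
    exact dsl_div τ u (zz_line_ne' _)
  have := shift g ?_ ?_ ?_ ?_
  · simp_rw [g0] at this
    rw [this]
    simp_rw [g1]
    exact integral_add_right_eq_self (fun v : ℝ => K τ u (zz v + 1) / L (zz v + 1)) ss
  · intro w h1 h2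
    have hw : w = (w.re : ℂ) + (w.im : ℂ) * I := (Complex.re_add_im w).symm
    refine DifferentiableAt.div ?_ ?_ ?_
    · exact ((dsl_diff (K_diff τ u)).comp zz_diff) w
    · exact ((dsl_diff L_diff).comp zz_diff) w
    · rw [hw]; exact dslL_ne h1 h2
  · simp_rw [g0]; exact K_int0 hτ u
  · simp_rw [g1]; exact (K_int1 hτ u).comp_add_right ss
  · obtain ⟨b1, t1, e1⟩ := F_dec hτ u
    obtain ⟨b2, t2, e2⟩ := F_dec one_pos (1/2)
    refine ⟨fun T => 2 * (b1 T + ‖F τ u 1‖ * b2 T), ?_, ?_⟩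
    · simpa using (t1.add (t2.const_mul ‖F τ u 1‖)).const_mul 2
    · filter_upwards [e1, e2, eventually_ge_atTop 3] with T h1 h2 hT y hy hy'
      have gen : ∀ T' : ℝ, |T'| = T → ‖F τ u (zz ((T' : ℂ) + y * I))‖ ≤ b1 T →
          ‖F 1 (1/2) (zz ((T' : ℂ) + y * I))‖ ≤ b2 T → ‖g ((T' : ℂ) + y * I)‖ ≤
          2 * (b1 T + ‖F τ u 1‖ * b2 T) := by
        intro T' hT' q1 q2
        have hbig := zz_big (T := T') (y := y) (by rw [hT']; exact hT) hy hy'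
        have hne : zz ((T' : ℂ) + y * I) ≠ 1 := by
          intro h; rw [h] at hbig; simp at hbig; linarith
        have hL := L_big hbig
        simp only [hg]
        rw [dsl_div τ u hne, norm_div]
        have hK : ‖K τ u (zz ((T' : ℂ) + y * I))‖ ≤ b1 T + ‖F τ u 1‖ * b2 T := by
          unfold K
          refine (norm_sub_le _ _).trans ?_
          rw [norm_mul]
          gcongr
        rw [div_le_iff₀ (by linarith)]
        nlinarith [norm_nonneg (K τ u (zz ((T' : ℂ) + y * I)))]
      have hT0 : |T| = T := abs_of_nonneg (by linarith)
      exact ⟨gen T hT0 (h1 y hy hy').1 (h2 y hy hy').1,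
        gen (-T) (by rw [abs_neg, hT0]) (h1 y hy hy').2 (h2 y hy hy').2⟩

lemma base_res : ee * (∫ v : ℝ, F 1 (1/2) (zz v + 1) / L (zz v + 1)) -
    ee * (∫ v : ℝ, F 1 (1/2) (zz v) / L (zz v)) = 1 := by
  rw [← mul_sub, ← integral_sub (FL_int1 one_pos _) (FL_int one_pos _)]
  have : ∀ v : ℝ, F 1 (1/2) (zz v + 1) / L (zz v + 1) - F 1 (1/2) (zz v) / L (zz v) =
      - F 1 (-1/2) (zz v) := by
    intro v
    have h := L_ne_line v
    rw [L_add_one, ← sub_div, div_eq_iff h]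
    unfold F L
    rw [neg_mul (Complex.exp _), mul_sub, ← Complex.exp_add, mul_one]
    have : -(π:ℂ) * I * ((1 : ℝ) : ℂ) * (zz v + 1) ^ 2 + 2 * π * I * (1 / 2) * (zz v + 1) =
      -(π:ℂ) * I * ((1 : ℝ) : ℂ) * (zz v) ^ 2 + 2 * π * I * (-1 / 2) * (zz v) := by
      push_cast; ring
    rw [this]
    ring_nf
  simp_rw [this]
  rw [integral_neg, F_gauss one_pos, ee]
  simp only [Real.sqrt_one, div_one, Complex.ofReal_one, one_mul]
  rw [mul_neg, ← Complex.exp_add]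
  have : 3 * (π:ℂ) * I / 4 + π * I * (-1 / 2) ^ 2 = π * I := by ring
  rw [this, Complex.exp_pi_mul_I]; norm_num

lemma Ups_tau {τ : ℝ} (hτ : 0 < τ) (u : ℂ) :
    Upsilon u τ = Complex.exp (-(π:ℂ) * I * τ + 2 * π * I * u) * (Upsilon (u - τ) τ - 1) := by
  have h := K_shift hτ u
  have e0 : ∫ v : ℝ, K τ u (zz v) / L (zz v) = (∫ v : ℝ, F τ u (zz v) / L (zz v)) -
      F τ u 1 * ∫ v : ℝ, F 1 (1/2) (zz v) / L (zz v) := by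
    rw [← integral_const_mul, ← integral_sub (FL_int hτ u) ((FL_int one_pos _).const_mul _)]
    congr 1; ext v; unfold K; ring
  have e1 : ∫ v : ℝ, K τ u (zz v + 1) / L (zz v + 1) =
      (∫ v : ℝ, F τ u (zz v + 1) / L (zz v + 1)) -
      F τ u 1 * ∫ v : ℝ, F 1 (1/2) (zz v + 1) / L (zz v + 1) := by
    rw [← integral_const_mul, ← integral_sub (FL_int1 hτ u) ((FL_int1 one_pos _).const_mul _)]
    congr 1; ext v; unfold K; ring
  have e2 : ∫ v : ℝ, F τ u (zz v + 1) / L (zz v + 1) =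
      Complex.exp (-(π:ℂ) * I * τ + 2 * π * I * u) * ∫ v : ℝ, F τ (u - τ) (zz v) / L (zz v) := by
    rw [← integral_const_mul]
    congr 1; ext v; rw [F_add_one, L_add_one]; ring
  have hF : F τ u 1 = Complex.exp (-(π:ℂ) * I * τ + 2 * π * I * u) := by
    unfold F; ring_nf
  rw [Ups_eq, Ups_eq, integral_const_mul, integral_const_mul]
  have hb := base_res
  rw [e0, e1, e2] at h
  rw [← hF] at h ⊢
  linear_combination ee * h - F τ u 1 * hb

lemma Ups_add_nat {τ : ℝ} (hτ : 0 < τ) (u : ℂ) (m : ℕ) :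
    Upsilon (u + m) τ = Upsilon u τ + ee * ((1 / Real.sqrt τ : ℝ) : ℂ) *
      ∑ j ∈ Finset.range m, Complex.exp (π * I * (u + j) ^ 2 / τ) := by
  induction m with
  | zero => simp
  | succ k ih =>
    rw [Finset.sum_range_succ, show u + ((k + 1 : ℕ) : ℂ) = (u + k) + 1 by push_cast; ring,
      Ups_succ hτ, ih]
    ring

lemma Ups_tau_nat {τ : ℝ} (hτ : 0 < τ) (u : ℂ) (n : ℕ) :
    Upsilon u τ = Complex.exp (-(π:ℂ) * I * τ * n ^ 2 + 2 * π * I * u * n) *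
      Upsilon (u - n * τ) τ - ∑ k ∈ Finset.range n,
        Complex.exp (-(π:ℂ) * I * τ * (k + 1) ^ 2 + 2 * π * I * u * (k + 1)) := by
  induction n with
  | zero => simp
  | succ k ih =>
    rw [Finset.sum_range_succ, ih, Ups_tau hτ (u - k * τ),
      show u - ((k + 1 : ℕ) : ℂ) * τ = u - k * τ - τ by push_cast; ring, ← mul_assoc,
      ← Complex.exp_add]
    have : -(π:ℂ) * I * τ * k ^ 2 + 2 * π * I * u * k +
        (-(π:ℂ) * I * τ + 2 * π * I * (u - k * τ)) =
        -(π:ℂ) * I * τ * (k + 1) ^ 2 + 2 * π * I * u * (k + 1) := by ring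
    rw [this]
    push_cast
    ring

lemma exp_congr {a b : ℂ} (n : ℤ) (h : a = b + n * (2 * π * I)) :
    Complex.exp a = Complex.exp b := Complex.exp_eq_exp_iff_exists_int.2 ⟨n, h⟩

end MI

open MI in
theorem statement9 (m n : ℕ) (hm : 1 ≤ m) (hn : 1 ≤ n) (u : ℂ) :
    (Complex.exp ((π:ℂ)*I*(n:ℂ)*((m:ℂ) + 2*u)) - 1) * Upsilon u ((m:ℂ)/(n:ℂ)) =
      Complex.exp (3*(π:ℂ)*I/4) * ((Real.sqrt n : ℂ)/(Real.sqrt m : ℂ)) *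
          ∑ j ∈ Finset.range m, Complex.exp ((π:ℂ)*I*((j:ℂ) + u)^2*(n:ℂ)/(m:ℂ))
        + Complex.exp ((π:ℂ)*I*((m:ℂ) + u)^2*(n:ℂ)/(m:ℂ)) *
          ∑ j ∈ Finset.range n,
            Complex.exp (-(π:ℂ)*I*((j:ℂ) + (n:ℂ)*u/(m:ℂ))^2*(m:ℂ)/(n:ℂ)) := by
  have hm' : (0:ℝ) < m := by exact_mod_cast hm
  have hn' : (0:ℝ) < n := by exact_mod_cast hn
  have hmC : (m:ℂ) ≠ 0 := by exact_mod_cast hm'.ne'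
  have hnC : (n:ℂ) ≠ 0 := by exact_mod_cast hn'.ne'
  set τ : ℝ := (m:ℝ) / n with hτdef
  have hτ : 0 < τ := by positivity
  have hτC : (m:ℂ) / (n:ℂ) = (τ : ℂ) := by rw [hτdef]; push_cast; rfl
  have hsq : ((1 / Real.sqrt τ : ℝ) : ℂ) = (Real.sqrt n : ℂ)/(Real.sqrt m : ℂ) := by
    rw [hτdef, Real.sqrt_div hm'.le, one_div_div]; push_cast; rfl
  have hnτ : (n:ℂ) * τ = m := by rw [← hτC]; field_simp
  rw [hτC]
  have A := Ups_tau_nat hτ u n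
  have B := Ups_add_nat hτ (u - m) m
  rw [sub_add_cancel, hsq] at B
  rw [hnτ] at A
  have X : Complex.exp (-(π:ℂ) * I * τ * n ^ 2 + 2 * π * I * u * n) =
      Complex.exp ((π:ℂ)*I*(n:ℂ)*((m:ℂ) + 2*u)) := by
    apply exp_congr (-(m * n : ℤ))
    push_cast
    linear_combination (-(π:ℂ) * I * n) * hnτ
  rw [X] at A
  set E := Complex.exp ((π:ℂ)*I*(n:ℂ)*((m:ℂ) + 2*u)) with hE
  have S1 : E * ∑ j ∈ Finset.range m, Complex.exp (π * I * (u - m + j) ^ 2 / τ) =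
      ∑ j ∈ Finset.range m, Complex.exp ((π:ℂ)*I*((j:ℂ) + u)^2*(n:ℂ)/(m:ℂ)) := by
    rw [Finset.mul_sum]
    refine Finset.sum_congr rfl fun j _ => ?_
    rw [hE, ← Complex.exp_add]
    apply exp_congr ((m * n - j * n : ℤ))
    rw [← hτC]
    push_cast
    field_simp
    ring
  have S2 : ∑ k ∈ Finset.range n,
        Complex.exp (-(π:ℂ) * I * τ * (k + 1) ^ 2 + 2 * π * I * u * (k + 1)) =
      Complex.exp ((π:ℂ)*I*((m:ℂ) + u)^2*(n:ℂ)/(m:ℂ)) *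
          ∑ j ∈ Finset.range n,
            Complex.exp (-(π:ℂ)*I*((j:ℂ) + (n:ℂ)*u/(m:ℂ))^2*(m:ℂ)/(n:ℂ)) := by
    rw [Finset.mul_sum, ← Finset.sum_range_reflect]
    refine Finset.sum_congr rfl fun j hj => ?_
    have hj' := Finset.mem_range.1 hj
    have hc : ((n - 1 - j : ℕ) : ℂ) = n - 1 - j := by
      rw [Nat.cast_sub (by omega), Nat.cast_sub hn]; simp
    rw [hc, ← Complex.exp_add]
    apply exp_congr ((m * j - m * n : ℤ))
    rw [← hτC]
    push_cast
    field_simp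
    ring
  rw [← S1, ← S2]
  change _ = ee * _ * _ + _
  linear_combination E * B - A

end
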